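/- Let {x_n} ⊂ D[0, T] be a sequence of real càdlàg functions, M > 0, and {ε_n} a vanishing sequence of positive reals such that each x_n satisfies x_n(0) = 0 and |x_n(t) − x_n(s)| ≤ M|t − s| + ε_n for all s, t ∈ [0, T]. Then {x_n} is relatively compact in D[0, T] with the uniform metric, and every limit point of {x_n} is an M-Lipschitz function vanishing at 0. -/

import Mathlib

/-- A function on `[0,T]` with values in a topological space is càdlàg if it is
right-continuous and has left limits. -/
def Cadlag {E : Type*} [TopologicalSpace E] {T : ℝ} (f : Set.Icc (0 : ℝ) T → E) : Prop :=
  (∀ t : Set.Icc (0 : ℝ) T, ContinuousWithinAt f (Set.Ici t) t) ∧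
  (∀ t : Set.Icc (0 : ℝ) T, 0 < t.1 → ∃ l : E, Filter.Tendsto f (nhdsWithin t (Set.Iio t)) (nhds l))

/-- A real function that is `K`-Lipschitz up to an additive error `δ` lies within `δ` above a
`K`-Lipschitz function, namely its infimal convolution with `K * dist`. -/
theorem exists_lipschitzWith_le_le_of_abs_sub_le {α : Type*} [PseudoMetricSpace α] {K : NNReal}
    {δ : ℝ} {f : α → ℝ} (hf : ∀ s t, |f t - f s| ≤ K * dist t s + δ) :
    ∃ g : α → ℝ, LipschitzWith K g ∧ ∀ t, f t - δ ≤ g t ∧ g t ≤ f t := by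
  have lower : ∀ t s, f t - δ ≤ f s + K * dist t s := fun t s => by
    linarith [(abs_le.mp (hf s t)).2]
  have bdd : ∀ t, BddBelow (Set.range fun s => f s + K * dist t s) := fun t =>
    ⟨f t - δ, by rintro _ ⟨s, rfl⟩; exact lower t s⟩
  refine ⟨fun t => ⨅ s, f s + K * dist t s, LipschitzWith.of_le_add_mul K fun t u => ?_,
    fun t => ⟨?_, ?_⟩⟩
  · have : Nonempty α := ⟨t⟩
    rw [← sub_le_iff_le_add]
    refine le_ciInf fun s => ?_
    have h := ciInf_le (bdd t) s
    have := mul_le_mul_of_nonneg_left (dist_triangle t u s) K.2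
    simp only [NNReal.val_eq_coe] at this
    linarith
  · have : Nonempty α := ⟨t⟩
    exact le_ciInf (lower t)
  · simpa using ciInf_le (bdd t) t

/-- On a compact metric space, a uniformly bounded sequence of `K`-Lipschitz real functions has a
uniformly convergent subsequence. -/
theorem exists_subseq_tendstoUniformly_of_lipschitzWith {α : Type*} [PseudoMetricSpace α]
    [CompactSpace α] {K : NNReal} {R : ℝ} {g : ℕ → α → ℝ} (hg : ∀ n, LipschitzWith K (g n))
    (hR : ∀ n t, |g n t| ≤ R) :
    ∃ ψ : ℕ → ℕ, StrictMono ψ ∧ ∃ y : α → ℝ,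
      TendstoUniformly (fun k => g (ψ k)) y Filter.atTop := by
  let G : ℕ → BoundedContinuousFunction α ℝ := fun n =>
    BoundedContinuousFunction.mkOfCompact ⟨g n, (hg n).continuous⟩
  have hcompact : IsCompact (closure (Set.range G)) := by
    refine BoundedContinuousFunction.arzela_ascoli (Set.Icc (-R) R) isCompact_Icc _ ?_ ?_
    · rintro _ t ⟨n, rfl⟩
      exact abs_le.mp (hR n t)
    · refine (LipschitzWith.uniformEquicontinuous _ K ?_).equicontinuous
      rintro ⟨_, n, rfl⟩
      exact hg n
  obtain ⟨y, -, ψ, hψ, hlim⟩ :=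
    hcompact.tendsto_subseq fun n => subset_closure (Set.mem_range_self n)
  exact ⟨ψ, hψ, y, BoundedContinuousFunction.tendsto_iff_tendstoUniformly.mp hlim⟩

/-- A sequence of càdlàg functions vanishing at `0` that are `M`-Lipschitz up to vanishing
additive errors `ε_n` is relatively compact in `D[0,T]` with the uniform metric, and every
limit point is an `M`-Lipschitz function vanishing at `0`. -/
theorem stmt15 (T : ℝ) (hT : 0 ≤ T) (M : ℝ) (hM : 0 < M)
    (x : ℕ → Set.Icc (0 : ℝ) T → ℝ) (hx : ∀ n, Cadlag (x n))
    (ε : ℕ → ℝ) (hεpos : ∀ n, 0 < ε n) (hε : Filter.Tendsto ε Filter.atTop (nhds 0))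
    (hx0 : ∀ n, x n ⟨0, Set.left_mem_Icc.mpr hT⟩ = 0)
    (hxLip : ∀ n, ∀ s t : Set.Icc (0 : ℝ) T,
      |x n t - x n s| ≤ M * |(t : ℝ) - (s : ℝ)| + ε n) :
    (∀ φ : ℕ → ℕ, StrictMono φ → ∃ ψ : ℕ → ℕ, StrictMono ψ ∧
      ∃ y : Set.Icc (0 : ℝ) T → ℝ,
        TendstoUniformly (fun k => x (φ (ψ k))) y Filter.atTop) ∧
    (∀ y : Set.Icc (0 : ℝ) T → ℝ,
      (∃ φ : ℕ → ℕ, StrictMono φ ∧ TendstoUniformly (fun k => x (φ k)) y Filter.atTop) →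
      y ⟨0, Set.left_mem_Icc.mpr hT⟩ = 0 ∧
      ∀ s t : Set.Icc (0 : ℝ) T, |y t - y s| ≤ M * |(t : ℝ) - (s : ℝ)|) := by
  have hdist : ∀ s t : Set.Icc (0 : ℝ) T, |(t : ℝ) - s| = dist t s := fun s t => rfl
  refine ⟨fun φ hφ => ?_, ?_⟩
  · lift M to NNReal using hM.le
    choose g hgLip hg using fun n =>
      exists_lipschitzWith_le_le_of_abs_sub_le (f := x n) (hxLip n)
    obtain ⟨B, hB⟩ := hε.bddAbove_range
    have hbound : ∀ n t, |g n t| ≤ B + M * T := fun n t => by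
      have hLip := (hgLip n).dist_le_mul t ⟨0, Set.left_mem_Icc.mpr hT⟩
      rw [Real.dist_eq, ← hdist, sub_zero, abs_of_nonneg t.2.1] at hLip
      have hεB : ε n ≤ B := hB (Set.mem_range_self n)
      have h0 := hg n ⟨0, Set.left_mem_Icc.mpr hT⟩
      rw [hx0] at h0
      have hMT := mul_le_mul_of_nonneg_left t.2.2 hM.le
      have := abs_le.mp hLip
      have := hεpos n
      exact abs_le.mpr ⟨by linarith, by linarith⟩
    obtain ⟨ψ, hψ, y, hy⟩ := exists_subseq_tendstoUniformly_of_lipschitzWith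
      (fun n => hgLip (φ n)) (fun n => hbound (φ n))
    refine ⟨ψ, hψ, y, ?_⟩
    have hε' := hε.comp (hφ.comp hψ).tendsto_atTop
    rw [Metric.tendstoUniformly_iff] at hy ⊢
    intro η hη
    filter_upwards [hy (η / 2) (half_pos hη), hε'.eventually_lt_const (half_pos hη)]
      with k hk hεk t
    have hkt := abs_lt.mp (hk t)
    have hgt := hg (φ (ψ k)) t
    simp only [Function.comp_apply] at hεk
    exact abs_lt.mpr ⟨by linarith, by linarith⟩
  · rintro y ⟨φ, hφ, hy⟩
    have hlim := fun t => hy.tendsto_at t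
    refine ⟨tendsto_nhds_unique (hlim _) (by simp [hx0]), fun s t => ?_⟩
    have hbound := (hε.comp hφ.tendsto_atTop).const_add (M * |(t : ℝ) - s|)
    rw [add_zero] at hbound
    exact le_of_tendsto_of_tendsto' ((hlim t).sub (hlim s)).abs hbound
      fun k => hxLip (φ k) s t
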